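/- Let G ~ G(n,1/2) and let N_x(G) be the number of x-cliques in G. Define X = N_x(G) − 2^{−C(x,2)}·C(n,x) (so E[X] = 0). If x ≥ 2 and n ≥ x²q(q+2) and q is a positive even integer, then E[X^q] < 2·q!·((x²/x!)·n^{x−1})^q. -/

import Mathlib

/-- The edge type of the complete graph on `[n]`: 2-element subsets. -/
abbrev EdgeIdx (n : ℕ) := {p : Finset (Fin n) // p.card = 2}

/-- The number of `x`-cliques of the graph given by the edge indicator
`g : EdgeIdx n → Bool`. -/
def numCliques (n x : ℕ) (g : EdgeIdx n → Bool) : ℕ :=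
  (((Finset.univ : Finset (Fin n)).powersetCard x).filter
    (fun V => ∀ e : EdgeIdx n, e.val ⊆ V → g e = true)).card

/-- Centered clique indicator. -/
noncomputable def cY (n x : ℕ) (V : Finset (Fin n)) (g : EdgeIdx n → Bool) : ℝ :=
  (if ∀ e : EdgeIdx n, e.val ⊆ V → g e = true then 1 else 0) - ((2 : ℝ) ^ (x.choose 2))⁻¹

lemma cY_abs (n x : ℕ) (V : Finset (Fin n)) (g : EdgeIdx n → Bool) : |cY n x V g| ≤ 1 := by
  unfold cY
  have h1 : (0 : ℝ) ≤ ((2 : ℝ) ^ (x.choose 2))⁻¹ := by positivity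
  have h2 : ((2 : ℝ) ^ (x.choose 2))⁻¹ ≤ 1 := inv_le_one_of_one_le₀ (one_le_pow₀ (by norm_num))
  rw [abs_le]
  split_ifs <;> constructor <;> linarith

lemma cY_sum (n x : ℕ) (g : EdgeIdx n → Bool) :
    (numCliques n x g : ℝ) - ((2 : ℝ) ^ (x.choose 2))⁻¹ * (n.choose x : ℝ) =
      ∑ V ∈ (Finset.univ : Finset (Fin n)).powersetCard x, cY n x V g := by
  unfold cY numCliques
  rw [Finset.sum_sub_distrib, Finset.sum_boole]
  simp [Finset.card_powersetCard, mul_comm]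

lemma card_edges_in (n : ℕ) (V : Finset (Fin n)) :
    Fintype.card {e : EdgeIdx n // e.val ⊆ V} = V.card.choose 2 := by
  rw [← Finset.card_powersetCard, ← Fintype.card_coe]
  refine Fintype.card_congr
    { toFun := fun e => ⟨e.1.1, by
        rw [Finset.mem_powersetCard]; exact ⟨e.2, e.1.2⟩⟩
      invFun := fun s => ⟨⟨s.1, (Finset.mem_powersetCard.1 s.2).2⟩,
        (Finset.mem_powersetCard.1 s.2).1⟩
      left_inv := fun e => rfl
      right_inv := fun s => rfl }

lemma indep_zero (n x : ℕ) (V : Finset (Fin n)) (hV : V.card = x)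
    (F : (EdgeIdx n → Bool) → ℝ)
    (hF : ∀ g g' : EdgeIdx n → Bool, (∀ e, ¬ e.val ⊆ V → g e = g' e) → F g = F g') :
    ∑ g : EdgeIdx n → Bool, cY n x V g * F g = 0 := by
  classical
  let φ := Equiv.piEquivPiSubtypeProd (fun e : EdgeIdx n => e.val ⊆ V) (fun _ => Bool)
  rw [← Equiv.sum_comp φ.symm, Fintype.sum_prod_type, Finset.sum_comm]
  refine Finset.sum_eq_zero fun b _ => ?_
  have h1 : ∀ a, F (φ.symm (a, b)) = F (φ.symm (fun _ => true, b)) := by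
    intro a
    apply hF
    intro e he
    simp [φ, Equiv.piEquivPiSubtypeProd, he]
  have h2 : ∀ a, cY n x V (φ.symm (a, b)) =
      (if a = fun _ => true then 1 else 0) - ((2 : ℝ) ^ (x.choose 2))⁻¹ := by
    intro a
    unfold cY
    congr 1
    refine if_congr ?_ rfl rfl
    constructor
    · intro h
      funext e
      have := h e.1 e.2
      simpa [φ, Equiv.piEquivPiSubtypeProd, e.2] using this
    · intro h e he
      simp [φ, Equiv.piEquivPiSubtypeProd, he, h]
  simp_rw [h1, h2]
  rw [← Finset.sum_mul, Finset.sum_sub_distrib]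
  have h3 : Fintype.card ({e : EdgeIdx n // e.val ⊆ V} → Bool) = 2 ^ (x.choose 2) := by
    rw [Fintype.card_fun, card_edges_in, hV, Fintype.card_bool]
  rw [Finset.sum_const, Finset.card_univ, h3]
  simp

/-- The family of `x`-sets sharing an edge with `V`. -/
lemma card_share (n x : ℕ) (V : Finset (Fin n)) (hV : V.card = x) :
    ((((Finset.univ : Finset (Fin n)).powersetCard x).filter
      (fun W => ∃ e : EdgeIdx n, e.val ⊆ V ∧ e.val ⊆ W)).card : ℝ) ≤
      (x.choose 2 : ℝ) * ((n : ℝ) ^ (x - 2) / ((x - 2).factorial : ℝ)) := by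
  classical
  have h1 : ((Finset.univ : Finset (Fin n)).powersetCard x).filter
      (fun W => ∃ e : EdgeIdx n, e.val ⊆ V ∧ e.val ⊆ W) ⊆
      (V.powersetCard 2).biUnion (fun e =>
        ((Finset.univ : Finset (Fin n)).powersetCard (x - 2)).image (fun U => U ∪ e)) := by
    intro W hW
    simp only [Finset.mem_filter, Finset.mem_powersetCard] at hW
    obtain ⟨⟨_, hW⟩, e, heV, heW⟩ := hW
    rw [Finset.mem_biUnion]
    refine ⟨e.1, Finset.mem_powersetCard.2 ⟨heV, e.2⟩, ?_⟩
    rw [Finset.mem_image]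
    refine ⟨W \ e.1, ?_, Finset.sdiff_union_of_subset heW⟩
    rw [Finset.mem_powersetCard, Finset.card_sdiff_of_subset heW, hW, e.2]
    exact ⟨Finset.subset_univ _, rfl⟩
  have h2 : (((Finset.univ : Finset (Fin n)).powersetCard x).filter
      (fun W => ∃ e : EdgeIdx n, e.val ⊆ V ∧ e.val ⊆ W)).card ≤ x.choose 2 * n.choose (x - 2) := by
    refine (Finset.card_le_card h1).trans ?_
    refine (Finset.card_biUnion_le_card_mul _ _ (n.choose (x - 2)) ?_).trans ?_
    · intro e _
      refine Finset.card_image_le.trans ?_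
      simp [Finset.card_powersetCard]
    · rw [Finset.card_powersetCard, hV]
  calc _ ≤ ((x.choose 2 * n.choose (x - 2) : ℕ) : ℝ) := by exact_mod_cast h2
    _ = (x.choose 2 : ℝ) * (n.choose (x - 2) : ℝ) := by push_cast; rfl
    _ ≤ _ := by
      gcongr
      exact Nat.choose_le_pow_div _ _

lemma recursion (n x k : ℕ) (d : ℝ)
    (hd : d = (x.choose 2 : ℝ) * ((n : ℝ) ^ (x - 2) / ((x - 2).factorial : ℝ)))
    (X : (EdgeIdx n → Bool) → ℝ)
    (hX : ∀ g, X g = ∑ V ∈ (Finset.univ : Finset (Fin n)).powersetCard x, cY n x V g) :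
    ∑ g, X g ^ (k + 2) ≤ (n.choose x : ℝ) * ∑ g, d * (k + 1) * (|X g| + d) ^ k := by
  classical
  have hd0 : 0 ≤ d := by rw [hd]; positivity
  have e1 : ∑ g, X g ^ (k + 2) =
      ∑ V ∈ (Finset.univ : Finset (Fin n)).powersetCard x, ∑ g, cY n x V g * X g ^ (k + 1) := by
    rw [Finset.sum_comm]
    refine Finset.sum_congr rfl fun g _ => ?_
    rw [← Finset.sum_mul, ← hX g]; ring
  have e2 : (n.choose x : ℝ) = (((Finset.univ : Finset (Fin n)).powersetCard x).card : ℝ) := by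
    simp [Finset.card_powersetCard]
  rw [e1, e2, ← nsmul_eq_mul]
  refine Finset.sum_le_card_nsmul _ _ _ fun V hV => ?_
  have hVc := (Finset.mem_powersetCard.1 hV).2
  let R : (EdgeIdx n → Bool) → ℝ := fun g =>
    ∑ W ∈ ((Finset.univ : Finset (Fin n)).powersetCard x).filter
      (fun W => ¬ ∃ e : EdgeIdx n, e.val ⊆ V ∧ e.val ⊆ W), cY n x W g
  have hz : ∑ g, cY n x V g * R g ^ (k + 1) = 0 := by
    apply indep_zero n x V hVc
    intro g g' h
    have : R g = R g' := by
      refine Finset.sum_congr rfl fun W hW => ?_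
      have hW2 := (Finset.mem_filter.1 hW).2
      unfold cY
      congr 1
      refine if_congr ?_ rfl rfl
      refine forall_congr' fun e => forall_congr' fun he => ?_
      rw [h e (fun hv => hW2 ⟨e, hv, he⟩)]
    simp only [this]
  have hdiff : ∀ g, |X g - R g| ≤ d := by
    intro g
    have : X g - R g = ∑ W ∈ ((Finset.univ : Finset (Fin n)).powersetCard x).filter
      (fun W => ∃ e : EdgeIdx n, e.val ⊆ V ∧ e.val ⊆ W), cY n x W g := by
      rw [hX g, sub_eq_iff_eq_add]
      exact (Finset.sum_filter_add_sum_filter_not _ _ _).symm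
    rw [this]
    refine (Finset.abs_sum_le_sum_abs _ _).trans ?_
    refine (Finset.sum_le_card_nsmul _ _ 1 fun W _ => cY_abs n x W g).trans ?_
    rw [nsmul_eq_mul, mul_one, hd]
    exact card_share n x V hVc
  have e3 : ∑ g, cY n x V g * X g ^ (k + 1) =
      ∑ g, cY n x V g * (X g ^ (k + 1) - R g ^ (k + 1)) := by
    simp_rw [mul_sub]
    rw [Finset.sum_sub_distrib, hz, sub_zero]
  rw [e3]
  refine Finset.sum_le_sum fun g _ => ?_
  have hR : |R g| ≤ |X g| + d := by
    have h1 := hdiff g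
    have h2 := abs_sub_abs_le_abs_sub (R g) (X g)
    rw [abs_sub_comm] at h2
    linarith
  have hmax : max |X g| |R g| ≤ |X g| + d := max_le (by linarith) hR
  calc _ ≤ |cY n x V g * (X g ^ (k + 1) - R g ^ (k + 1))| := le_abs_self _
    _ = |cY n x V g| * |X g ^ (k + 1) - R g ^ (k + 1)| := abs_mul _ _
    _ ≤ 1 * |X g ^ (k + 1) - R g ^ (k + 1)| := by
      gcongr; exact cY_abs n x V g
    _ = |X g ^ (k + 1) - R g ^ (k + 1)| := one_mul _
    _ ≤ |X g - R g| * ((k + 1 : ℕ) : ℝ) * max |X g| |R g| ^ k := abs_pow_sub_pow_le _ _ _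
    _ ≤ d * ((k + 1 : ℕ) : ℝ) * (|X g| + d) ^ k := by
      gcongr
      exact hdiff g
    _ = _ := by push_cast; rfl

lemma pow_bound (k : ℕ) (a B δ d : ℝ) (ha : 0 ≤ a) (hB : 0 ≤ B) (hδ : 0 ≤ δ) (hd0 : 0 ≤ d)
    (hkδ : k * δ ≤ 1 / 2) (hδ1 : δ ≤ 1) (hd : d ≤ δ * B) :
    (a + d) ^ k ≤ 2 * (a ^ k + B ^ k) := by
  have h2 : (1 + δ) ^ k ≤ 2 := by
    have hb : 1 / 2 ≤ (1 - δ) ^ k := by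
      have := one_add_mul_le_pow (a := -δ) (by linarith) k
      rw [← sub_eq_add_neg] at this
      linarith
    have hm : (1 + δ) ^ k * (1 - δ) ^ k ≤ 1 := by
      rw [← mul_pow]
      apply pow_le_one₀ <;> nlinarith
    have : 0 ≤ (1 + δ) ^ k := by positivity
    nlinarith
  have hak : 0 ≤ a ^ k := by positivity
  have hBk : 0 ≤ B ^ k := by positivity
  rcases le_total a B with h | h
  · calc (a + d) ^ k ≤ ((1 + δ) * B) ^ k := by
          apply pow_le_pow_left₀ (by positivity); linarith
      _ = (1 + δ) ^ k * B ^ k := mul_pow _ _ _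
      _ ≤ 2 * B ^ k := by gcongr
      _ ≤ _ := by linarith
  · calc (a + d) ^ k ≤ ((1 + δ) * a) ^ k := by
          apply pow_le_pow_left₀ (by positivity); nlinarith
      _ = (1 + δ) ^ k * a ^ k := mul_pow _ _ _
      _ ≤ 2 * a ^ k := by gcongr
      _ ≤ _ := by linarith

/-- Corollary: for `G ~ G(n,1/2)` and
`X = N_x(G) − 2^{−C(x,2)}·C(n,x)` (so `E[X] = 0`), if `x ≥ 2`,
`n ≥ x²q(q+2)` and `q` is a positive even integer, then
`E[X^q] < 2·q!·((x²/x!)·n^{x−1})^q`. The expectation over `G(n,1/2)` is the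
uniform average over all edge indicator functions. -/
theorem clique_count_moment_bound (n x q : ℕ) (hx : 2 ≤ x) (hq : 0 < q)
    (hqe : Even q) (hn : x ^ 2 * q * (q + 2) ≤ n) :
    (∑ g : EdgeIdx n → Bool,
        ((numCliques n x g : ℝ) -
          ((2 : ℝ) ^ (x.choose 2))⁻¹ * (n.choose x : ℝ)) ^ q) /
      (Fintype.card (EdgeIdx n → Bool) : ℝ) <
      2 * (q.factorial : ℝ) *
        (((x : ℝ) ^ 2 / (x.factorial : ℝ)) * (n : ℝ) ^ (x - 1)) ^ q := by
  classical
  obtain ⟨y, rfl⟩ : ∃ y, x = y + 2 := ⟨x - 2, by omega⟩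
  have hnR : ((y : ℝ) + 2) ^ 2 * q * (q + 2) ≤ n := by exact_mod_cast hn
  have hq0 : (0 : ℝ) < q := by exact_mod_cast hq
  have hn0 : (0 : ℝ) < n := lt_of_lt_of_le (by positivity) hnR
  simp_rw [cY_sum]
  set X : (EdgeIdx n → Bool) → ℝ :=
    fun g => ∑ V ∈ (Finset.univ : Finset (Fin n)).powersetCard (y + 2), cY n (y + 2) V g with hX
  set B : ℝ := (((y + 2 : ℕ) : ℝ) ^ 2 / ((y + 2).factorial : ℝ)) * (n : ℝ) ^ (y + 2 - 1) with hB
  have hB0 : 0 < B := by positivity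
  obtain ⟨d, hd⟩ : ∃ d : ℝ, d = ((y + 2).choose 2 : ℝ) *
    ((n : ℝ) ^ (y + 2 - 2) / ((y + 2 - 2).factorial : ℝ)) := ⟨_, rfl⟩
  have hd0 : 0 ≤ d := by rw [hd]; positivity
  have hc : ((y + 2).choose 2 : ℝ) = (y + 2) * (y + 1) / 2 := by
    rw [Nat.cast_choose_two]; push_cast; ring
  have hf : ((y + 2).factorial : ℝ) = (y + 2) * ((y + 1) * y.factorial) := by
    simp only [Nat.factorial_succ]; push_cast; ring
  have hyf : (0 : ℝ) < y.factorial := by positivity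
  have hd' : d = (y + 2) * (y + 1) / 2 * ((n : ℝ) ^ y / y.factorial) := by
    rw [hd, hc]; simp
  have hB' : B = (y + 2) / ((y + 1) * y.factorial) * (n : ℝ) ^ y * n := by
    rw [hB, hf]; push_cast
    rw [pow_succ (n : ℝ) y]; field_simp
  set δ : ℝ := 1 / (2 * q * (q + 2)) with hδ
  have hδ0 : 0 ≤ δ := by positivity
  have hdB : d ≤ δ * B := by
    rw [hd', hB', hδ]
    have h1 : ((y : ℝ) + 1) ^ 2 * (q * (q + 2)) ≤ n := by
      refine le_trans ?_ hnR
      rw [mul_assoc]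
      gcongr
      norm_num
    have h2 : 1 / (2 * q * ((q : ℝ) + 2)) *
        ((y + 2) / ((y + 1) * y.factorial) * (n : ℝ) ^ y * n) -
        (y + 2) * (y + 1) / 2 * ((n : ℝ) ^ y / y.factorial) =
        (y + 2) / ((y + 1) * y.factorial) * (n : ℝ) ^ y / (2 * q * (q + 2)) *
        (n - ((y : ℝ) + 1) ^ 2 * (q * (q + 2))) := by
      field_simp
    have h3 : 0 ≤ n - ((y : ℝ) + 1) ^ 2 * (q * (q + 2)) := by linarith
    rw [← sub_nonneg, h2]
    positivity
  have hNd : (n.choose (y + 2) : ℝ) * d ≤ B ^ 2 / 2 := by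
    have h1 : (n.choose (y + 2) : ℝ) ≤ (n : ℝ) ^ (y + 2) / ((y + 2).factorial : ℝ) :=
      Nat.choose_le_pow_div _ _
    calc (n.choose (y + 2) : ℝ) * d ≤ (n : ℝ) ^ (y + 2) / ((y + 2).factorial : ℝ) * d := by gcongr
      _ = ((n : ℝ) ^ y * n / y.factorial) ^ 2 / 2 * 1 := by
        rw [hf, hd', pow_add]; field_simp
      _ ≤ ((n : ℝ) ^ y * n / y.factorial) ^ 2 / 2 * (((y : ℝ) + 2) / (y + 1)) ^ 2 := by
        gcongr
        apply one_le_pow₀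
        rw [le_div_iff₀ (by positivity)]; linarith
      _ = B ^ 2 / 2 := by rw [hB']; field_simp
  have hδ2 : q * δ ≤ 1 / 2 := by
    rw [hδ, mul_one_div, div_le_div_iff₀ (by positivity) (by norm_num)]
    nlinarith
  have hδ1 : δ ≤ 1 := by
    have : (1 : ℝ) ≤ q := by exact_mod_cast hq
    nlinarith
  set c : ℝ := (Fintype.card (EdgeIdx n → Bool) : ℝ) with hcdef
  have hc0 : 0 < c := by
    rw [hcdef]; exact_mod_cast Fintype.card_pos
  have key : ∀ j : ℕ, 2 * j ≤ q → ∑ g, X g ^ (2 * j) ≤ ((2 * j).factorial : ℝ) * c * B ^ (2 * j) := by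
    intro j
    induction j with
    | zero => intro _; simp [hcdef]
    | succ j ih =>
      intro hj
      have ih := ih (by omega)
      rw [show 2 * (j + 1) = 2 * j + 2 by ring]
      obtain ⟨k, hk⟩ : ∃ k, k = 2 * j := ⟨_, rfl⟩
      have hev : Even k := ⟨j, by omega⟩
      rw [← hk] at ih ⊢
      have hkq : k ≤ q := by omega
      have hkδ : k * δ ≤ 1 / 2 := by
        refine le_trans ?_ hδ2
        gcongr
      have h1 := recursion n (y + 2) k d hd X (fun g => rfl)
      have h2 : ∑ g, d * (k + 1) * (|X g| + d) ^ k ≤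
          d * (k + 1) * (2 * (∑ g, X g ^ k + c * B ^ k)) := by
        rw [← Finset.mul_sum]
        gcongr
        calc ∑ g, (|X g| + d) ^ k ≤ ∑ g, 2 * (X g ^ k + B ^ k) := by
              refine Finset.sum_le_sum fun g _ => ?_
              have := pow_bound k |X g| B δ d (abs_nonneg _) hB0.le hδ0 hd0 hkδ hδ1 hdB
              rwa [hev.pow_abs] at this
          _ = _ := by
              rw [← Finset.mul_sum, Finset.sum_add_distrib, Finset.sum_const, nsmul_eq_mul,
                Finset.card_univ]
      have hfac : (1 : ℝ) ≤ k.factorial := by exact_mod_cast Nat.factorial_pos k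
      have h3 : ∑ g, X g ^ k + c * B ^ k ≤ 2 * (k.factorial * (c * B ^ k)) := by
        have : 0 ≤ c * B ^ k := by positivity
        nlinarith
      calc ∑ g, X g ^ (k + 2) ≤ (n.choose (y + 2) : ℝ) *
            (d * (k + 1) * (2 * (2 * (k.factorial * (c * B ^ k))))) := by
            refine h1.trans ?_
            gcongr
            refine h2.trans ?_
            gcongr
        _ = ((n.choose (y + 2) : ℝ) * d) * ((k + 1) * (2 * (2 * (k.factorial * (c * B ^ k))))) := by
            ring
        _ ≤ (B ^ 2 / 2) * ((k + 1) * (2 * (2 * (k.factorial * (c * B ^ k))))) := by gcongr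
        _ = 2 * ((k + 1) * k.factorial * c * B ^ (k + 2)) := by ring
        _ ≤ (k + 2) * ((k + 1) * k.factorial * c * B ^ (k + 2)) := by
            gcongr
            linarith [(Nat.cast_nonneg k : (0 : ℝ) ≤ k)]
        _ = _ := by
            simp only [Nat.factorial_succ]; push_cast; ring
  obtain ⟨j, hj⟩ := hqe
  have hk := key j (by omega)
  rw [show 2 * j = q by omega] at hk
  rw [div_lt_iff₀ hc0]
  have : 0 < (q.factorial : ℝ) * c * B ^ q := by positivity
  calc _ ≤ (q.factorial : ℝ) * c * B ^ q := hk
    _ < _ := by linarith
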